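/- For every integer k ≥ 0, the set of positions of the game T_k whose Sprague–Grundy value equals 1 is {(0,1), (1,0)} ∪ {(A_n + 2, B_n + 2) : n ≥ 0} ∪ {(B_n + 2, A_n + 2) : n ≥ 0}; in particular this set is independent of k. -/

import Mathlib

noncomputable def phi : ℝ := (1 + Real.sqrt 5) / 2
noncomputable def wA (n : ℕ) : ℕ := ⌊phi * n⌋₊
noncomputable def wB (n : ℕ) : ℕ := ⌊phi ^ 2 * n⌋₊

/-- A legal move in the game `T_k` from `p` to `q`: a Nim move, or a diagonal move
removing `s` tokens from both piles, with `min p.1 p.2 - s > 0` and the integer ratios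
of larger over smaller entry before and after the move differing by at most `k`. -/
def TkMove (k : ℕ) (p q : ℕ × ℕ) : Prop :=
  (∃ t, 1 ≤ t ∧ t ≤ p.1 ∧ q = (p.1 - t, p.2)) ∨
  (∃ t, 1 ≤ t ∧ t ≤ p.2 ∧ q = (p.1, p.2 - t)) ∨
  (∃ s, 1 ≤ s ∧ s ≤ min p.1 p.2 ∧ 0 < min p.1 p.2 - s ∧
    |((max (p.1 - s) (p.2 - s) / min (p.1 - s) (p.2 - s) : ℕ) : ℤ) -
      ((max p.1 p.2 / min p.1 p.2 : ℕ) : ℤ)| ≤ (k : ℤ) ∧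
    q = (p.1 - s, p.2 - s))

/-- `S` is the set of P-positions of the game with move relation `move`. -/
def IsPPositions (move : ℕ × ℕ → ℕ × ℕ → Prop) (S : Set (ℕ × ℕ)) : Prop :=
  (∀ p ∈ S, ∀ q ∈ S, ¬ move p q) ∧ (∀ p ∉ S, ∃ q ∈ S, move p q)

/-- `G` is the Sprague–Grundy function of the game with move relation `move`:
at every position, `G` takes the mex of the values of the options. -/
def IsGrundy (move : ℕ × ℕ → ℕ × ℕ → Prop) (G : ℕ × ℕ → ℕ) : Prop :=
  ∀ p, (∀ q, move p q → G q ≠ G p) ∧ (∀ v, v < G p → ∃ q, move p q ∧ G q = v)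

theorem phi_eq_goldenRatio : phi = Real.goldenRatio := rfl

theorem wA_zero : wA 0 = 0 := by simp [wA]

theorem wB_eq (n : ℕ) : wB n = wA n + n := by
  have h : phi ^ 2 * n = phi * n + n := by
    rw [phi_eq_goldenRatio, Real.goldenRatio_sq]; ring
  rw [wB, wA, h, Nat.floor_add_natCast]
  rw [phi_eq_goldenRatio]
  exact mul_nonneg Real.goldenRatio_pos.le n.cast_nonneg

theorem wA_strictMono : StrictMono wA := by
  refine strictMono_nat_of_lt_succ fun n => ?_
  have h0 : 0 ≤ phi * n := mul_nonneg Real.goldenRatio_pos.le n.cast_nonneg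
  have h1 : (1 : ℝ) < phi := Real.one_lt_goldenRatio
  rw [Nat.lt_iff_add_one_le, wA, wA, ← Nat.floor_add_one h0]
  refine Nat.floor_le_floor ?_
  push_cast
  linarith

theorem holderConjugate_phi : Real.HolderConjugate phi (phi ^ 2) := by
  have h1 : (1 : ℝ) < phi := Real.one_lt_goldenRatio
  have h2 : phi ^ 2 = phi + 1 := Real.goldenRatio_sq
  rw [Real.holderConjugate_iff]
  refine ⟨h1, ?_⟩
  have : phi ≠ 0 := by positivity
  field_simp
  linarith

theorem beattySeq_natCast_phi (n : ℕ) : beattySeq phi n = wA n := by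
  have h0 : 0 ≤ phi * n := mul_nonneg Real.goldenRatio_pos.le n.cast_nonneg
  rw [beattySeq, wA, Int.natCast_floor_eq_floor h0, mul_comm, Int.cast_natCast]

theorem beattySeq_natCast_phi_sq (n : ℕ) : beattySeq (phi ^ 2) n = wB n := by
  have h0 : 0 ≤ phi ^ 2 * n := by positivity
  rw [beattySeq, wB, Int.natCast_floor_eq_floor h0, mul_comm, Int.cast_natCast]

/-- The lower and upper Wythoff sequences partition the positive integers. -/
theorem beattySeq_phi_symmDiff :
    symmDiff {x | ∃ k > 0, beattySeq phi k = x} {x | ∃ k > 0, beattySeq (phi ^ 2) k = x} =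
      {n : ℤ | 0 < n} :=
  Irrational.beattySeq_symmDiff_beattySeq_pos holderConjugate_phi Real.goldenRatio_irrational

theorem exists_wA_or_wB (a : ℕ) : (∃ n, a = wA n) ∨ ∃ n, a = wB n := by
  rcases Nat.eq_zero_or_pos a with rfl | ha
  · exact Or.inl ⟨0, wA_zero.symm⟩
  have h : (a : ℤ) ∈ {n : ℤ | 0 < n} := Int.natCast_pos.2 ha
  rw [← beattySeq_phi_symmDiff] at h
  rcases h with ⟨⟨k, hk, hka⟩, -⟩ | ⟨⟨k, hk, hka⟩, -⟩
  all_goals lift k to ℕ using hk.le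
  · rw [beattySeq_natCast_phi] at hka
    exact Or.inl ⟨k, by omega⟩
  · rw [beattySeq_natCast_phi_sq] at hka
    exact Or.inr ⟨k, by omega⟩

theorem wA_ne_wB {m n : ℕ} (hn : 0 < n) : wA m ≠ wB n := by
  intro h
  have hm : 0 < m := by
    rw [Nat.pos_iff_ne_zero]
    rintro rfl
    rw [wA_zero, wB_eq] at h
    omega
  have hpos : ((wB n : ℕ) : ℤ) ∈ {n : ℤ | 0 < n} := by
    have := wB_eq n
    simp only [Set.mem_ofPred_eq]
    omega
  have hA : ((wB n : ℕ) : ℤ) ∈ {x | ∃ k > 0, beattySeq phi k = x} :=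
    ⟨m, by omega, by rw [beattySeq_natCast_phi, h]⟩
  have hB : ((wB n : ℕ) : ℤ) ∈ {x | ∃ k > 0, beattySeq (phi ^ 2) k = x} :=
    ⟨n, by omega, beattySeq_natCast_phi_sq n⟩
  rw [← beattySeq_phi_symmDiff] at hpos
  rcases hpos with ⟨-, h'⟩ | ⟨-, h'⟩
  · exact h' hB
  · exact h' hA

/-- `(a, b)` is a Wythoff pair, in either order. -/
def IsWythoffPair (a b : ℕ) : Prop :=
  ∃ n, (a = wA n ∧ b = wB n) ∨ (a = wB n ∧ b = wA n)

namespace IsWythoffPair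

theorem symm {a b : ℕ} (h : IsWythoffPair a b) : IsWythoffPair b a := by
  obtain ⟨n, h⟩ := h
  exact ⟨n, by tauto⟩

theorem right_unique {a b b' : ℕ} (h : IsWythoffPair a b) (h' : IsWythoffPair a b') :
    b = b' := by
  obtain ⟨m, hm⟩ := h
  obtain ⟨n, hn⟩ := h'
  have em := wB_eq m
  have en := wB_eq n
  have z := wA_zero
  have hmn : m = n := by
    rcases hm with ⟨hm, -⟩ | ⟨hm, -⟩ <;> rcases hn with ⟨hn, -⟩ | ⟨hn, -⟩
    · exact wA_strictMono.injective (hm.symm.trans hn)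
    · rcases Nat.eq_zero_or_pos n with rfl | h
      · exact wA_strictMono.injective (by omega)
      · exact absurd (hm.symm.trans hn) (wA_ne_wB h)
    · rcases Nat.eq_zero_or_pos m with rfl | h
      · exact wA_strictMono.injective (by omega)
      · exact absurd (hn.symm.trans hm) (wA_ne_wB h)
    · rcases lt_trichotomy m n with h | h | h
      · have := wA_strictMono h
        omega
      · exact h
      · have := wA_strictMono h
        omega
  subst hmn
  omega

theorem eq_zero_of_add {a b s : ℕ} (h : IsWythoffPair a b) (h' : IsWythoffPair (a + s) (b + s)) :
    s = 0 := by
  obtain ⟨m, hm⟩ := h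
  obtain ⟨n, hn⟩ := h'
  have em := wB_eq m
  have en := wB_eq n
  have hmn : m = n := by omega
  subst hmn
  omega

end IsWythoffPair

theorem exists_isWythoffPair_of_le {a b : ℕ} (hab : a ≤ b) (h : ¬IsWythoffPair a b) :
    (∃ b' < b, IsWythoffPair a b') ∨
      ∃ s, 1 ≤ s ∧ b ≤ a + (a - s) ∧ s ≤ a ∧ IsWythoffPair (a - s) (b - s) := by
  rcases exists_wA_or_wB a with ⟨n, hn⟩ | ⟨n, hn⟩
  · have en := wB_eq n
    rcases lt_trichotomy b (wB n) with hb | hb | hb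
    · right
      have em := wB_eq (b - a)
      have hlt : wA (b - a) < wA n := wA_strictMono (by omega)
      have hle := wA_strictMono.le_apply (x := b - a)
      exact ⟨a - wA (b - a), by omega, by omega, by omega, b - a, Or.inl ⟨by omega, by omega⟩⟩
    · exact absurd ⟨n, Or.inl ⟨hn, hb⟩⟩ h
    · exact Or.inl ⟨wB n, hb, n, Or.inl ⟨hn, rfl⟩⟩
  · have en := wB_eq n
    have hne : b ≠ wA n := fun hb => h ⟨n, Or.inr ⟨hn, hb⟩⟩
    exact Or.inl ⟨wA n, by omega, n, Or.inr ⟨hn, rfl⟩⟩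

theorem TkMove.swap {k a b a' b' : ℕ} (h : TkMove k (a, b) (a', b')) :
    TkMove k (b, a) (b', a') := by
  rcases h with ⟨t, h1, h2, h3⟩ | ⟨t, h1, h2, h3⟩ | ⟨s, h1, h2, h3, h4, h5⟩
  · refine Or.inr (Or.inl ⟨t, h1, h2, ?_⟩)
    simp_all
  · refine Or.inl ⟨t, h1, h2, ?_⟩
    simp_all
  · refine Or.inr (Or.inr ⟨s, h1, ?_, ?_, ?_, ?_⟩)
    · simpa only [min_comm] using h2
    · simpa only [min_comm] using h3
    · simpa only [min_comm, max_comm] using h4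
    · simp_all

theorem tkMove_left {k a a' b : ℕ} (h : a' < a) : TkMove k (a, b) (a', b) :=
  Or.inl ⟨a - a', by omega, by simp, by simp; omega⟩

theorem tkMove_right {k a b b' : ℕ} (h : b' < b) : TkMove k (a, b) (a, b') :=
  (tkMove_left h).swap

theorem max_div_min_eq_one {a b : ℕ} (hab : a ≤ b) (h : b < 2 * a) : max a b / min a b = 1 := by
  rw [max_eq_right hab, min_eq_left hab]
  exact Nat.div_eq_of_lt_le (by omega) (by omega)

/-- Diagonal moves between positions of integer ratio one are legal. -/
theorem tkMove_diag {k a b s : ℕ} (hab : a ≤ b) (hs : 1 ≤ s) (hsa : s < a)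
    (h : b - s < 2 * (a - s)) : TkMove k (a, b) (a - s, b - s) := by
  refine Or.inr (Or.inr ⟨s, hs, ?_, ?_, ?_, rfl⟩)
  · simp only [le_min_iff]
    omega
  · simp only [min_eq_left hab]
    omega
  · simp only
    rw [max_div_min_eq_one hab (by omega), max_div_min_eq_one (by omega) h]
    simp

theorem exists_tkMove_isWythoffPair {k a b c : ℕ} (hc : 0 < c) (h : ¬IsWythoffPair a b) :
    ∃ a' b', IsWythoffPair a' b' ∧ TkMove k (a + c, b + c) (a' + c, b' + c) := by
  wlog hab : a ≤ b generalizing a b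
  · obtain ⟨a', b', h1, h2⟩ := this (fun h' => h h'.symm) (by omega : b ≤ a)
    exact ⟨b', a', h1.symm, h2.swap⟩
  rcases exists_isWythoffPair_of_le hab h with ⟨b', hb, hw⟩ | ⟨s, h1, h2, h3, hw⟩
  · exact ⟨a, b', hw, tkMove_right (by omega)⟩
  · refine ⟨a - s, b - s, hw, ?_⟩
    rw [← Nat.sub_add_comm h3, ← Nat.sub_add_comm (h3.trans hab)]
    exact tkMove_diag (by omega) h1 (by omega) (by omega)

theorem not_tkMove_of_isWythoffPair {k a b a' b' : ℕ} (c : ℕ) (h : IsWythoffPair a b)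
    (h' : IsWythoffPair a' b') : ¬TkMove k (a + c, b + c) (a' + c, b' + c) := by
  rintro (⟨t, h1, h2, h3⟩ | ⟨t, h1, h2, h3⟩ | ⟨s, h1, h2, -, -, h5⟩)
  · simp only [Prod.mk.injEq] at h2 h3
    obtain rfl : b' = b := by omega
    have := h.symm.right_unique h'.symm
    omega
  · simp only [Prod.mk.injEq] at h2 h3
    obtain rfl : a' = a := by omega
    have := h.right_unique h'
    omega
  · simp only [Prod.mk.injEq, le_min_iff] at h2 h5
    obtain rfl : a = a' + s := by omega
    obtain rfl : b = b' + s := by omega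
    have := h'.eq_zero_of_add h
    omega

/-- The Wythoff pairs shifted by `(c, c)`. -/
def shiftedWythoff (c : ℕ) : Set (ℕ × ℕ) :=
  {p | ∃ a b, IsWythoffPair a b ∧ p = (a + c, b + c)}

theorem mk_add_mem_shiftedWythoff {a b c : ℕ} :
    (a + c, b + c) ∈ shiftedWythoff c ↔ IsWythoffPair a b := by
  simp [shiftedWythoff]

theorem IsGrundy.eq_zero_iff {move : ℕ × ℕ → ℕ × ℕ → Prop} {G : ℕ × ℕ → ℕ} (hG : IsGrundy move G)
    {S : Set (ℕ × ℕ)} (hS : IsPPositions move S) (hwf : WellFounded (flip move)) (p : ℕ × ℕ) :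
    G p = 0 ↔ p ∈ S := by
  induction p using hwf.induction with
  | _ p ih =>
    constructor
    · intro h0
      by_contra hp
      obtain ⟨q, hq, hm⟩ := hS.2 p hp
      exact (hG p).1 q hm (((ih q hm).2 hq).trans h0.symm)
    · intro hp
      by_contra h0
      obtain ⟨q, hm, hq⟩ := (hG p).2 0 (Nat.pos_of_ne_zero h0)
      exact hS.1 p hp q ((ih q hm).1 hq) hm

theorem IsGrundy.eq_one_iff {move : ℕ × ℕ → ℕ × ℕ → Prop} {G : ℕ × ℕ → ℕ} (hG : IsGrundy move G)
    {S T : Set (ℕ × ℕ)} (hS : ∀ p, G p = 0 ↔ p ∈ S) (hST : Disjoint S T)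
    (hT : ∀ p ∈ T, ∀ q ∈ T, ¬move p q) (hT' : ∀ p ∉ S, p ∉ T → ∃ q ∈ T, move p q)
    (hwf : WellFounded (flip move)) (p : ℕ × ℕ) :
    G p = 1 ↔ p ∈ T := by
  induction p using hwf.induction with
  | _ p ih =>
    constructor
    · intro h1
      by_contra hp
      have hpS : p ∉ S := fun h => by have := (hS p).2 h; omega
      obtain ⟨q, hq, hm⟩ := hT' p hpS hp
      exact (hG p).1 q hm (((ih q hm).2 hq).trans h1.symm)
    · intro hp
      by_contra h1
      have h0 : G p ≠ 0 := fun h => Set.disjoint_left.1 hST ((hS p).1 h) hp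
      obtain ⟨q, hm, hq⟩ := (hG p).2 1 (by omega)
      exact hT p hp q ((ih q hm).1 hq) hm

theorem TkMove.add_lt {k : ℕ} {p q : ℕ × ℕ} (h : TkMove k p q) : q.1 + q.2 < p.1 + p.2 := by
  rcases h with ⟨t, h1, h2, rfl⟩ | ⟨t, h1, h2, rfl⟩ | ⟨s, h1, h2, -, -, rfl⟩
  · simp only
    omega
  · simp only
    omega
  · simp only [le_min_iff] at h2 ⊢
    omega

theorem wellFounded_flip_tkMove (k : ℕ) : WellFounded (flip (TkMove k)) :=
  Subrelation.wf (fun h => TkMove.add_lt h) (measure fun p : ℕ × ℕ => p.1 + p.2).wf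

/-- A move to a position with an empty pile is a Nim move. -/
theorem TkMove.eq_or_eq {k a b a' b' : ℕ} (h : TkMove k (a, b) (a', b')) (h0 : a' = 0 ∨ b' = 0) :
    a' = a ∨ b' = b := by
  rcases h with ⟨t, h1, h2, h3⟩ | ⟨t, h1, h2, h3⟩ | ⟨s, h1, h2, h3, -, h5⟩
  · simp_all
  · simp_all
  · simp only [Prod.mk.injEq, lt_min_iff, Nat.sub_pos_iff_lt] at h3 h5
    omega

theorem TkMove.le {k a b a' b' : ℕ} (h : TkMove k (a, b) (a', b')) : a' ≤ a ∧ b' ≤ b := by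
  rcases h with ⟨t, h1, h2, h3⟩ | ⟨t, h1, h2, h3⟩ | ⟨s, h1, h2, h3, -, h5⟩ <;>
    simp_all

theorem isPPositions_tkMove (k : ℕ) :
    IsPPositions (TkMove k) ({(0, 0)} ∪ shiftedWythoff 1) := by
  constructor
  · rintro p (rfl | ⟨a, b, h, rfl⟩) q (rfl | ⟨a', b', h', rfl⟩) hm
    · simpa using hm.add_lt
    · simpa using hm.le
    · simpa using hm.eq_or_eq (Or.inl rfl)
    · exact not_tkMove_of_isWythoffPair 1 h h' hm
  · rintro ⟨a, b⟩ hp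
    rcases a with - | a
    · rcases b with - | b
      · simp at hp
      · exact ⟨(0, 0), Or.inl rfl, tkMove_right (by omega)⟩
    · rcases b with - | b
      · exact ⟨(0, 0), Or.inl rfl, tkMove_left (by omega)⟩
      · have h : ¬IsWythoffPair a b := fun h => hp (Or.inr ⟨a, b, h, rfl⟩)
        obtain ⟨a', b', h1, h2⟩ := exists_tkMove_isWythoffPair one_pos h
        exact ⟨_, Or.inr ⟨a', b', h1, rfl⟩, h2⟩

theorem isWythoffPair_zero : IsWythoffPair 0 0 :=
  ⟨0, Or.inl ⟨wA_zero.symm, by rw [wB_eq, wA_zero]⟩⟩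

theorem not_isWythoffPair_succ {a b : ℕ} (h : IsWythoffPair a b) :
    ¬IsWythoffPair (a + 1) (b + 1) := fun h' => one_ne_zero (h.eq_zero_of_add h')

theorem not_tkMove_within_grundyOne (k : ℕ) :
    ∀ p ∈ ({(0, 1), (1, 0)} ∪ shiftedWythoff 2 : Set (ℕ × ℕ)),
      ∀ q ∈ ({(0, 1), (1, 0)} ∪ shiftedWythoff 2 : Set (ℕ × ℕ)), ¬TkMove k p q := by
  rintro p ((rfl | rfl) | ⟨a, b, h, rfl⟩) q ((rfl | rfl) | ⟨a', b', h', rfl⟩) hm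
  case inr.inr => exact not_tkMove_of_isWythoffPair 2 h h' hm
  case inr.inl.inl =>
    have := hm.eq_or_eq (Or.inl rfl)
    omega
  case inr.inl.inr =>
    have := hm.eq_or_eq (Or.inr rfl)
    omega
  all_goals
    have h1 := hm.add_lt
    have h2 := hm.le
    simp only at h1
    omega

theorem exists_tkMove_grundyOne (k : ℕ) :
    ∀ p ∉ ({(0, 0)} ∪ shiftedWythoff 1 : Set (ℕ × ℕ)),
      p ∉ ({(0, 1), (1, 0)} ∪ shiftedWythoff 2 : Set (ℕ × ℕ)) →
      ∃ q ∈ ({(0, 1), (1, 0)} ∪ shiftedWythoff 2 : Set (ℕ × ℕ)), TkMove k p q := by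
  rintro ⟨a, b⟩ hS hT
  have h00 : ¬(a = 0 ∧ b = 0) := by
    rintro ⟨rfl, rfl⟩
    exact hS (Or.inl rfl)
  have h11 : ¬(a = 1 ∧ b = 1) := by
    rintro ⟨rfl, rfl⟩
    exact hS (Or.inr ⟨0, 0, isWythoffPair_zero, rfl⟩)
  have h01 : ¬(a = 0 ∧ b = 1) := by
    rintro ⟨rfl, rfl⟩
    exact hT (Or.inl (Or.inl rfl))
  have h10 : ¬(a = 1 ∧ b = 0) := by
    rintro ⟨rfl, rfl⟩
    exact hT (Or.inl (Or.inr rfl))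
  by_cases hmin : 2 ≤ a ∧ 2 ≤ b
  · obtain ⟨a, rfl⟩ := Nat.exists_eq_add_of_le' hmin.1
    obtain ⟨b, rfl⟩ := Nat.exists_eq_add_of_le' hmin.2
    have h : ¬IsWythoffPair a b := fun h => hT (Or.inr ⟨a, b, h, rfl⟩)
    obtain ⟨a', b', h1, h2⟩ := exists_tkMove_isWythoffPair two_pos h
    exact ⟨_, Or.inr ⟨a', b', h1, rfl⟩, h2⟩
  · obtain ⟨rfl, hb⟩ | ⟨rfl, hb⟩ | ⟨rfl, ha⟩ | ⟨rfl, ha⟩ :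
        (a = 0 ∧ 1 < b) ∨ (a = 1 ∧ 0 < b) ∨ (b = 0 ∧ 1 < a) ∨ (b = 1 ∧ 0 < a) := by omega
    · exact ⟨(0, 1), Or.inl (Or.inl rfl), tkMove_right hb⟩
    · exact ⟨(1, 0), Or.inl (Or.inr rfl), tkMove_right hb⟩
    · exact ⟨(1, 0), Or.inl (Or.inr rfl), tkMove_left ha⟩
    · exact ⟨(0, 1), Or.inl (Or.inl rfl), tkMove_left ha⟩

theorem disjoint_grundyZero_grundyOne :
    Disjoint ({(0, 0)} ∪ shiftedWythoff 1 : Set (ℕ × ℕ))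
      ({(0, 1), (1, 0)} ∪ shiftedWythoff 2) := by
  rw [Set.disjoint_left]
  rintro p (rfl | ⟨a, b, h, rfl⟩) ((hp | hp) | ⟨a', b', h', hp⟩)
  case inr.inr =>
    simp only [Prod.mk.injEq] at hp
    obtain rfl : a = a' + 1 := by omega
    obtain rfl : b = b' + 1 := by omega
    exact not_isWythoffPair_succ h' h
  all_goals simp [Prod.ext_iff] at hp

theorem Tk_grundy_one (k : ℕ) (G : ℕ × ℕ → ℕ) (hG : IsGrundy (TkMove k) G) :
    {p : ℕ × ℕ | G p = 1} =
      ({((0 : ℕ), (1 : ℕ)), ((1 : ℕ), (0 : ℕ))} : Set (ℕ × ℕ)) ∪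
      {p : ℕ × ℕ | ∃ n, p = (wA n + 2, wB n + 2)} ∪
      {p : ℕ × ℕ | ∃ n, p = (wB n + 2, wA n + 2)} := by
  ext p
  rw [Set.mem_ofPred_eq, hG.eq_one_iff
    (hG.eq_zero_iff (isPPositions_tkMove k) (wellFounded_flip_tkMove k))
    disjoint_grundyZero_grundyOne (not_tkMove_within_grundyOne k) (exists_tkMove_grundyOne k)
    (wellFounded_flip_tkMove k), Set.union_assoc]
  refine or_congr Iff.rfl ⟨?_, ?_⟩
  · rintro ⟨a, b, ⟨n, ⟨rfl, rfl⟩ | ⟨rfl, rfl⟩⟩, rfl⟩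
    · exact Or.inl ⟨n, rfl⟩
    · exact Or.inr ⟨n, rfl⟩
  · rintro (⟨n, rfl⟩ | ⟨n, rfl⟩)
    · exact ⟨_, _, ⟨n, Or.inl ⟨rfl, rfl⟩⟩, rfl⟩
    · exact ⟨_, _, ⟨n, Or.inr ⟨rfl, rfl⟩⟩, rfl⟩
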